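/- Let H be a countable right-orderable group, let a < b be real numbers with I = (a, b) the open interval, and let x, y ∈ I with x < y. Let f, g ∈ H∖{1} with f ≠ g. Then there exists an injective group homomorphism σ from H to the group of order-preserving bijections of I (written as a right action) such that y·σ(g) < x·σ(f). -/

import Mathlib

/-- A group is right-orderable if there is a strict total order on it invariant
under right multiplication. -/
def IsRightOrderable (H : Type*) [Group H] : Prop :=
  ∃ lt : H → H → Prop, IsStrictTotalOrder H lt ∧ ∀ f g h : H, lt f g → lt (f * h) (g * h)

/-- A right action of `H` on the open interval `I = (a, b)` by orientation-preserving
homeomorphisms: a map to order-preserving bijections of `I` with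
`x·ν(gh) = (x·ν(g))·ν(h)`. -/
def IsIntervalRightAction {H : Type*} [Group H] {a b : ℝ}
    (ν : H → (Set.Ioo a b ≃o Set.Ioo a b)) : Prop :=
  ∀ g h : H, ν (g * h) = (ν g).trans (ν h)

/-- The extension of an order automorphism of `ℚ` to a self-map of `ℝ`. -/
noncomputable def ratExtend (φ : ℚ ≃o ℚ) (r : ℝ) : ℝ :=
  sSup ((fun q : ℚ => (φ q : ℝ)) '' {q : ℚ | (q : ℝ) ≤ r})

theorem ratExtend_le_iff (φ : ℚ ≃o ℚ) (r : ℝ) (q : ℚ) :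
    ratExtend φ r ≤ φ q ↔ r ≤ q := by
  have ub : ∀ s : ℚ, r ≤ s →
      (φ s : ℝ) ∈ upperBounds ((fun q : ℚ => (φ q : ℝ)) '' {q : ℚ | (q : ℝ) ≤ r}) := by
    rintro s hs _ ⟨t, ht, rfl⟩
    have hts : t ≤ s := by exact_mod_cast le_trans ht hs
    exact Rat.cast_le.2 (φ.monotone hts)
  constructor
  · intro h
    by_contra! hlt
    obtain ⟨t, hqt, htr⟩ := exists_rat_btwn hlt
    obtain ⟨s, hs⟩ := exists_rat_gt r
    have h1 : (φ t : ℝ) ≤ ratExtend φ r := le_csSup ⟨_, ub s hs.le⟩ ⟨t, htr.le, rfl⟩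
    have h2 : φ q < φ t := φ.strictMono (by exact_mod_cast hqt)
    have h3 : (φ q : ℝ) < φ t := by exact_mod_cast h2
    linarith
  · intro h
    obtain ⟨s, hs⟩ := exists_rat_lt r
    exact csSup_le ⟨_, s, hs.le, rfl⟩ (ub q h)

theorem le_iff_forall_rat_le (r s : ℝ) : r ≤ s ↔ ∀ q : ℚ, s ≤ q → r ≤ q := by
  refine ⟨fun h q hq => h.trans hq, fun h => ?_⟩
  by_contra! hlt
  obtain ⟨t, hst, htr⟩ := exists_rat_btwn hlt
  exact absurd (h t hst.le) htr.not_ge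

theorem ratExtend_le_ratExtend (φ : ℚ ≃o ℚ) (r s : ℝ) :
    ratExtend φ r ≤ ratExtend φ s ↔ r ≤ s := by
  rw [le_iff_forall_rat_le, le_iff_forall_rat_le r, ← φ.surjective.forall.symm]
  simp only [ratExtend_le_iff]

theorem eq_of_forall_rat_le_iff {r s : ℝ} (h : ∀ q : ℚ, r ≤ q ↔ s ≤ q) : r = s :=
  le_antisymm ((le_iff_forall_rat_le _ _).2 fun q => (h q).2)
    ((le_iff_forall_rat_le _ _).2 fun q => (h q).1)

theorem ratExtend_trans (φ ψ : ℚ ≃o ℚ) (r : ℝ) :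
    ratExtend (φ.trans ψ) r = ratExtend ψ (ratExtend φ r) := by
  refine eq_of_forall_rat_le_iff fun q => ?_
  obtain ⟨p, rfl⟩ := (φ.trans ψ).surjective q
  rw [ratExtend_le_iff, OrderIso.trans_apply, ratExtend_le_iff, ratExtend_le_iff]

theorem ratExtend_refl (r : ℝ) : ratExtend (OrderIso.refl ℚ) r = r :=
  eq_of_forall_rat_le_iff fun q => ratExtend_le_iff (OrderIso.refl ℚ) r q

theorem ratExtend_ratCast (φ : ℚ ≃o ℚ) (q : ℚ) : ratExtend φ q = φ q := by
  refine eq_of_forall_rat_le_iff fun t => ?_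
  obtain ⟨p, rfl⟩ := φ.surjective t
  rw [ratExtend_le_iff]
  norm_cast
  exact φ.le_iff_le.symm

/-- The extension of an order automorphism of `ℚ` to an order automorphism of `ℝ`. -/
noncomputable def ratExtendIso (φ : ℚ ≃o ℚ) : ℝ ≃o ℝ where
  toFun := ratExtend φ
  invFun := ratExtend φ.symm
  left_inv r := by rw [← ratExtend_trans, OrderIso.self_trans_symm, ratExtend_refl]
  right_inv r := by rw [← ratExtend_trans, OrderIso.symm_trans_self, ratExtend_refl]
  map_rel_iff' := ratExtend_le_ratExtend φ _ _

theorem exists_affine_orderIso {p q x y : ℝ} (hpq : p < q) (hxy : x < y) :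
    ∃ A : ℝ ≃o ℝ, A p = x ∧ A q = y := by
  have hc : 0 < (y - x) / (q - p) := div_pos (sub_pos.2 hxy) (sub_pos.2 hpq)
  have hne : q - p ≠ 0 := (sub_pos.2 hpq).ne'
  refine ⟨(OrderIso.mulLeft₀ _ hc).trans (OrderIso.addRight (x - (y - x) / (q - p) * p)), ?_, ?_⟩
  · simp
  · simp only [OrderIso.trans_apply, OrderIso.mulLeft₀_apply, OrderIso.addRight_apply]
    field_simp
    ring

theorem nonempty_real_orderIso_Ioo {a b : ℝ} (hab : a < b) :
    Nonempty (ℝ ≃o Set.Ioo a b) := by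
  obtain ⟨A, rfl, rfl⟩ := exists_affine_orderIso (p := -1) (q := 1) (by norm_num) hab
  refine ⟨(orderIsoIooNegOneOne ℝ).trans
    { toEquiv := A.toEquiv.subtypeEquiv fun t => ?_
      map_rel_iff' := A.le_iff_le }⟩
  exact (and_congr A.lt_iff_lt A.lt_iff_lt).symm

/-- A countable group with a right-invariant order acts on `ℚ` by order automorphisms, with a
point whose orbit map is strictly increasing. -/
theorem exists_rat_action_of_rightOrder {H : Type*} [Group H] [Countable H] [LinearOrder H]
    (hmul : ∀ f g h : H, f < g → f * h < g * h) :
    ∃ (ν : H → (ℚ ≃o ℚ)) (p : ℚ), (∀ g h, ν (g * h) = (ν g).trans (ν h)) ∧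
      StrictMono fun h => ν h p := by
  have hmul_iff : ∀ f g h : H, f * h < g * h ↔ f < g := fun f g h =>
    ⟨fun hlt => by simpa using hmul _ _ h⁻¹ hlt, hmul f g h⟩
  have : DenselyOrdered (H ×ₗ ℚ) := ⟨by
    intro u v huv
    obtain h | ⟨h₁, h₂⟩ := Prod.Lex.lt_iff.1 huv
    · exact ⟨toLex ((ofLex u).1, (ofLex u).2 + 1), Prod.Lex.lt_iff.2 (.inr ⟨rfl, lt_add_one _⟩),
        Prod.Lex.lt_iff.2 (.inl h)⟩
    · obtain ⟨t, ht₁, ht₂⟩ := exists_between h₂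
      exact ⟨toLex ((ofLex u).1, t), Prod.Lex.lt_iff.2 (.inr ⟨rfl, ht₁⟩),
        Prod.Lex.lt_iff.2 (.inr ⟨h₁, ht₂⟩)⟩⟩
  have : Countable (H ×ₗ ℚ) := inferInstanceAs (Countable (H × ℚ))
  have : Nonempty (H ×ₗ ℚ) := ⟨toLex (1, 0)⟩
  have : NoMinOrder (H ×ₗ ℚ) := ⟨fun u => ⟨toLex ((ofLex u).1, (ofLex u).2 - 1),
    Prod.Lex.lt_iff.2 (.inr ⟨rfl, sub_one_lt _⟩)⟩⟩
  have : NoMaxOrder (H ×ₗ ℚ) := ⟨fun u => ⟨toLex ((ofLex u).1, (ofLex u).2 + 1),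
    Prod.Lex.lt_iff.2 (.inr ⟨rfl, lt_add_one _⟩)⟩⟩
  obtain ⟨e⟩ := Order.iso_of_countable_dense (H ×ₗ ℚ) ℚ
  let μ : H → (H ×ₗ ℚ ≃o H ×ₗ ℚ) := fun h =>
    { toFun := fun u => toLex ((ofLex u).1 * h, (ofLex u).2)
      invFun := fun u => toLex ((ofLex u).1 * h⁻¹, (ofLex u).2)
      left_inv := fun u => by simp
      right_inv := fun u => by simp
      map_rel_iff' := fun {u v} => by simp [Prod.Lex.le_iff, hmul_iff] }
  refine ⟨fun h => e.symm.trans ((μ h).trans e), e (toLex (1, 0)), fun g h => ?_, fun g h hgh => ?_⟩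
  · ext q
    simp [μ, mul_assoc]
  · simpa [μ, Prod.Lex.lt_iff] using hgh

theorem IsRightOrderable.exists_linearOrder_lt {H : Type*} [Group H] (hH : IsRightOrderable H)
    {f g : H} (hfg : f ≠ g) :
    ∃ _ : LinearOrder H, (∀ f g h : H, f < g → f * h < g * h) ∧ g < f := by
  classical
  obtain ⟨lt, hlt, hmul⟩ := hH
  let L : LinearOrder H := linearOrderOfSTO lt
  obtain h | h := lt_or_gt_of_ne hfg
  · exact ⟨(inferInstance : LinearOrder Hᵒᵈ), fun f g k hk => hmul g f k hk, h⟩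
  · exact ⟨L, hmul, h⟩

/-- Given distinct nontrivial elements `f ≠ g` of a countable right-orderable group `H`,
an open interval `I = (a, b)` and points `x < y` in `I`, there is a faithful right action
`σ` of `H` on `I` with `y·σ(g) < x·σ(f)`. -/
theorem exists_faithful_action_crossing
    {H : Type*} [Group H] [Countable H] (hH : IsRightOrderable H)
    {a b : ℝ} (hab : a < b)
    {x y : ℝ} (hx : x ∈ Set.Ioo a b) (hy : y ∈ Set.Ioo a b) (hxy : x < y)
    (f g : H) (hf : f ≠ 1) (hg : g ≠ 1) (hfg : f ≠ g) :
    ∃ σ : H → (Set.Ioo a b ≃o Set.Ioo a b),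
      IsIntervalRightAction σ ∧ Function.Injective σ ∧
      (σ g ⟨y, hy⟩ : ℝ) < (σ f ⟨x, hx⟩ : ℝ) := by
  obtain ⟨_, hmul, hlt⟩ := hH.exists_linearOrder_lt hfg
  obtain ⟨ν, p, hν, hmono⟩ := exists_rat_action_of_rightOrder hmul
  let N : H → (ℝ ≃o ℝ) := fun h => ratExtendIso (ν h)
  have hN : ∀ h, N h p = ν h p := fun h => ratExtend_ratCast (ν h) p
  have hNlt : N g p < N f p := by
    rw [hN, hN]
    exact_mod_cast hmono hlt
  obtain ⟨m, hgm, hmf⟩ := exists_between hNlt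
  have hpq : (p : ℝ) < (N g).symm m := (N g).lt_symm_apply.2 hgm
  obtain ⟨e⟩ := nonempty_real_orderIso_Ioo hab
  have hxy' : e.symm ⟨x, hx⟩ < e.symm ⟨y, hy⟩ := e.symm.strictMono hxy
  obtain ⟨A, hAp, hAq⟩ := exists_affine_orderIso hpq hxy'
  let E : ℝ ≃o Set.Ioo a b := A.trans e
  have hEp : E.symm ⟨x, hx⟩ = p := by
    rw [OrderIso.symm_apply_eq]
    simp [E, hAp]
  have hEq : E.symm ⟨y, hy⟩ = (N g).symm m := by
    rw [OrderIso.symm_apply_eq]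
    simp [E, hAq]
  refine ⟨fun h => E.symm.trans ((N h).trans E), fun h k => ?_, fun h k hhk => ?_, ?_⟩
  · ext t
    simp [N, ratExtendIso, hν, ratExtend_trans]
  · have h1 := DFunLike.congr_fun hhk ⟨x, hx⟩
    simp only [OrderIso.trans_apply, hEp, hN, EmbeddingLike.apply_eq_iff_eq, Rat.cast_inj] at h1
    exact hmono.injective h1
  · simpa only [OrderIso.trans_apply, hEp, hEq, OrderIso.apply_symm_apply, Subtype.coe_lt_coe,
      OrderIso.lt_iff_lt] using hmf
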